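/- arXiv:1806.08161 — 2 statements merged into one kernel-verified Lean document; each statement's English description precedes it below -/
import Mathlib

section
/- Let 0 < a < x and ε ∈ ℝ. Then lim_{β→0⁺} e^{−√(2β)·(x−a)} · (1 + (ε/2)·(ln(a/x) + e^{2√(2β)·a}·E₁(2√(2β)·a) − e^{2√(2β)·x}·E₁(2√(2β)·x))) = 1. -/
open Real Filter MeasureTheory

/-- The exponential integral E₁(z) = ∫_z^∞ e^{−u}/u du. -/
noncomputable def E1 (z : ℝ) : ℝ := ∫ u in Set.Ioi z, Real.exp (-u) / u

theorem E1_integrable (z : ℝ) (hz : 0 < z) :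
    IntegrableOn (fun u : ℝ => Real.exp (-u) / u) (Set.Ioi z) := by
  have h1 : IntegrableOn (fun u : ℝ => Real.exp (-u) / z) (Set.Ioi z) :=
    (integrableOn_exp_neg_Ioi z).div_const z
  refine Integrable.mono' h1 (by apply Measurable.aestronglyMeasurable; fun_prop) ?_
  refine (ae_restrict_iff' measurableSet_Ioi).2 (Eventually.of_forall fun u hu => ?_)
  have hu' : z < u := hu
  have : 0 < u := hz.trans hu'
  rw [Real.norm_of_nonneg (by positivity)]
  gcongr

theorem E1_nonneg (z : ℝ) (hz : 0 < z) : 0 ≤ E1 z := by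
  refine setIntegral_nonneg measurableSet_Ioi fun u hu => ?_
  have : 0 < u := hz.trans hu
  positivity

theorem E1_bound (z : ℝ) (hz : 0 < z) : z * E1 z ≤ Real.sqrt z * Real.Gamma (1/2) := by
  have hG := Real.GammaIntegral_convergent (s := 1/2) (by norm_num)
  have hle : E1 z ≤ ∫ u in Set.Ioi z, (Real.sqrt z)⁻¹ * (Real.exp (-u) * u ^ ((1/2:ℝ) - 1)) := by
    refine setIntegral_mono_on (E1_integrable z hz)
      ((hG.mono_set (Set.Ioi_subset_Ioi hz.le)).const_mul _) measurableSet_Ioi fun u hu => ?_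
    have hu' : z < u := hu
    have h0 : 0 < u := hz.trans hu'
    have e : u ^ ((1/2:ℝ) - 1) = (Real.sqrt u)⁻¹ := by
      rw [Real.sqrt_eq_rpow, ← Real.rpow_neg h0.le]; norm_num
    rw [e]
    have hs : 0 < Real.sqrt z := Real.sqrt_pos.2 hz
    have hsu : 0 < Real.sqrt u := Real.sqrt_pos.2 h0
    have : u⁻¹ ≤ (Real.sqrt z)⁻¹ * (Real.sqrt u)⁻¹ := by
      rw [← mul_inv]
      apply inv_anti₀ (by positivity)
      calc Real.sqrt z * Real.sqrt u ≤ Real.sqrt u * Real.sqrt u := by gcongr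
        _ = u := Real.mul_self_sqrt h0.le
    calc Real.exp (-u) / u = Real.exp (-u) * u⁻¹ := rfl
      _ ≤ Real.exp (-u) * ((Real.sqrt z)⁻¹ * (Real.sqrt u)⁻¹) := by gcongr
      _ = _ := by ring
  have hle2 : (∫ u in Set.Ioi z, Real.exp (-u) * u ^ ((1/2:ℝ) - 1)) ≤ Real.Gamma (1/2) := by
    rw [Real.Gamma_eq_integral (by norm_num)]
    refine setIntegral_mono_set hG ?_ (Set.Ioi_subset_Ioi hz.le).eventuallyLE
    refine (ae_restrict_iff' measurableSet_Ioi).2 (Eventually.of_forall fun u hu => ?_)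
    have hu' : 0 < u := hu
    show 0 ≤ _
    positivity
  rw [integral_const_mul] at hle
  have hs : 0 < Real.sqrt z := Real.sqrt_pos.2 hz
  calc z * E1 z ≤ z * ((Real.sqrt z)⁻¹ * Real.Gamma (1/2)) := by
        gcongr
        exact hle.trans (by gcongr)
    _ = _ := by
        nth_rewrite 1 [← Real.mul_self_sqrt hz.le]
        field_simp

theorem E1_diff (p q : ℝ) (hp : 0 < p) (hpq : p ≤ q) :
    Real.exp (-q) * Real.log (q / p) ≤ E1 p - E1 q ∧
    E1 p - E1 q ≤ Real.exp (-p) * Real.log (q / p) := by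
  have hq := hp.trans_le hpq
  have h := intervalIntegral.integral_Ioi_sub_Ioi (E1_integrable p hp) hpq
  have hi : IntervalIntegrable (fun u : ℝ => Real.exp (-u) / u) volume p q := by
    rw [intervalIntegrable_iff_integrableOn_Ioc_of_le hpq]
    exact (E1_integrable p hp).mono_set Set.Ioc_subset_Ioi_self
  have hc (c : ℝ) : IntervalIntegrable (fun u : ℝ => c * (1 / u)) volume p q := by
    refine (intervalIntegral.intervalIntegrable_one_div ?_ (by fun_prop)).const_mul c
    intro u hu
    rw [Set.uIcc_of_le hpq] at hu
    exact (hp.trans_le hu.1).ne'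
  have hl (c : ℝ) : c * Real.log (q / p) = ∫ u in p..q, c * (1 / u) := by
    rw [intervalIntegral.integral_const_mul, integral_one_div_of_pos hp hq]
  unfold E1
  rw [h, hl, hl]
  constructor
  · refine intervalIntegral.integral_mono_on hpq (hc _) hi fun u hu => ?_
    have : 0 < u := hp.trans_le hu.1
    rw [mul_one_div]
    have := hu.2
    gcongr
  · refine intervalIntegral.integral_mono_on hpq hi (hc _) fun u hu => ?_
    have : 0 < u := hp.trans_le hu.1
    rw [mul_one_div]
    have := hu.1
    gcongr

theorem key (a x : ℝ) (ha : 0 < a) (hax : a < x) :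
    Tendsto (fun t : ℝ => Real.exp (t * a) * E1 (t * a) - Real.exp (t * x) * E1 (t * x))
      (nhdsWithin 0 (Set.Ioi 0)) (nhds (Real.log (x / a))) := by
  have hx := ha.trans hax
  have hL : 0 ≤ Real.log (x / a) := Real.log_nonneg ((one_le_div ha).2 hax.le)
  have l1 : Tendsto (fun t : ℝ => Real.exp (t * a) * (Real.exp (-(t * x)) * Real.log (x / a))
      - Real.exp (t * x) * (Real.sqrt (t * x) * Real.Gamma (1/2)))
      (nhdsWithin 0 (Set.Ioi 0)) (nhds (Real.log (x / a))) := by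
    have : Continuous (fun t : ℝ => Real.exp (t * a) * (Real.exp (-(t * x)) * Real.log (x / a))
      - Real.exp (t * x) * (Real.sqrt (t * x) * Real.Gamma (1/2))) := by fun_prop
    have h := this.tendsto 0
    simp only [zero_mul, neg_zero, Real.exp_zero, one_mul, Real.sqrt_zero, sub_zero] at h
    exact h.mono_left nhdsWithin_le_nhds
  refine tendsto_of_tendsto_of_tendsto_of_le_of_le' l1 tendsto_const_nhds ?_ ?_
  all_goals
    filter_upwards [self_mem_nhdsWithin] with t ht
    have ht : 0 < t := ht
    have hta : 0 < t * a := by positivity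
    have htx : 0 < t * x := by positivity
    have hle : t * a ≤ t * x := by gcongr
    obtain ⟨d1, d2⟩ := E1_diff (t * a) (t * x) hta hle
    rw [mul_div_mul_left _ _ ht.ne'] at d1 d2
    have n := E1_nonneg _ htx
    have b := E1_bound _ htx
    have e1 : Real.exp (t * a) ≤ Real.exp (t * x) := Real.exp_le_exp.2 hle
    have e2 : 1 ≤ Real.exp (t * a) := Real.one_le_exp hta.le
    have e3 : Real.exp (t * x) - 1 ≤ t * x * Real.exp (t * x) := by
      have h1 := Real.add_one_le_exp (-(t * x))
      have h2 : Real.exp (-(t*x)) * Real.exp (t * x) = 1 := by rw [← Real.exp_add]; simp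
      nlinarith [Real.exp_pos (t * x)]
  · have k1 := mul_le_mul_of_nonneg_left d1 (Real.exp_pos (t * a)).le
    have k2 : (Real.exp (t * x) - Real.exp (t * a)) * E1 (t * x)
        ≤ (t * x * Real.exp (t * x)) * E1 (t * x) :=
      mul_le_mul_of_nonneg_right (by linarith) n
    have k3 := mul_le_mul_of_nonneg_left b (Real.exp_pos (t * x)).le
    linarith
  · have k1 := mul_le_mul_of_nonneg_left d2 (Real.exp_pos (t * a)).le
    rw [← mul_assoc, ← Real.exp_add, add_neg_cancel, Real.exp_zero, one_mul] at k1
    have k2 := mul_le_mul_of_nonneg_right e1 n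
    linarith

/-- Full integrability of the first-order perturbed Bessel first passage time density:
the first-order truncated Laplace transform tends to 1 as β → 0⁺. -/
theorem stmt_12 (a x ε : ℝ) (ha : 0 < a) (hax : a < x) :
    Tendsto (fun β : ℝ =>
        Real.exp (-(Real.sqrt (2 * β)) * (x - a)) *
          (1 + (ε / 2) *
            (Real.log (a / x) +
              Real.exp (2 * Real.sqrt (2 * β) * a) * E1 (2 * Real.sqrt (2 * β) * a) -
              Real.exp (2 * Real.sqrt (2 * β) * x) * E1 (2 * Real.sqrt (2 * β) * x))))
      (nhdsWithin 0 (Set.Ioi 0)) (nhds 1) := by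
  have ht : Tendsto (fun β : ℝ => 2 * Real.sqrt (2 * β)) (nhdsWithin 0 (Set.Ioi 0))
      (nhdsWithin 0 (Set.Ioi 0)) := by
    refine tendsto_nhdsWithin_iff.2 ⟨?_, ?_⟩
    · have : Continuous (fun β : ℝ => 2 * Real.sqrt (2 * β)) := by fun_prop
      have h := this.tendsto 0
      simp only [mul_zero, Real.sqrt_zero] at h
      exact h.mono_left nhdsWithin_le_nhds
    · filter_upwards [self_mem_nhdsWithin] with β hβ
      have : 0 < β := hβ
      rw [Set.mem_Ioi]
      positivity
  have h1 := (key a x ha hax).comp ht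
  have h2 : Tendsto (fun β : ℝ => Real.exp (-(Real.sqrt (2 * β)) * (x - a)))
      (nhdsWithin 0 (Set.Ioi 0)) (nhds 1) := by
    have : Continuous (fun β : ℝ => Real.exp (-(Real.sqrt (2 * β)) * (x - a))) := by fun_prop
    have h := this.tendsto 0
    simp only [mul_zero, Real.sqrt_zero, neg_zero, zero_mul, Real.exp_zero] at h
    exact h.mono_left nhdsWithin_le_nhds
  have h3 := h2.mul (((h1.const_add (Real.log (a / x))).const_mul (ε / 2)).const_add 1)
  have e : Real.log (a / x) + Real.log (x / a) = 0 := by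
    rw [← inv_div x a, Real.log_inv]; ring
  rw [e, mul_zero, add_zero, mul_one] at h3
  refine h3.congr fun β => ?_
  simp only [Function.comp]
  ring
end

section
/- Let 0 < a < x, β > 0 and γ = √(2β). Define ρ(t) = (2π)^{−1/2}·t^{−5/2}·((x−a)² − t)·e^{−(x−a)²/(2t)} and, for α > 0 and s > 0, p_Γ(y,α,s) = s^α·y^{α−1}·e^{−sy}/Γ(α). Define η(x,t) = (1/2)·ln(x/a)·ρ(t) − (1/(4t))·∫_{(x−a)²}^∞ (p_Γ(y,3/2,1/(2t)) − p_Γ(y,1/2,1/(2t))) · (1/(√y − x + 3a) + 1/(√y + x + a)) dy. Then ∫₀^∞ e^{−βt}·η(x,t) dt = −γ·e^{−γ(x−a)}·(ln(a/x) + e^{2γa}·E₁(2γa) + e^{2γx}·E₁(2γx))/2. -/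
open Real Filter MeasureTheory

/-- Density of the Gamma distribution with shape α and rate s. -/
noncomputable def pGamma (y α s : ℝ) : ℝ :=
  s ^ α * y ^ (α - 1) * Real.exp (-s * y) / Real.Gamma α

open Topology

lemma aux_ftc {g g' : ℝ → ℝ} {l m : ℝ} (hd : ∀ t, 0 < t → HasDerivAt g (g' t) t)
    (hpos : ∀ t, 0 < t → 0 ≤ g' t) (h0 : Tendsto g (𝓝[>] 0) (𝓝 m)) (hl : Tendsto g atTop (𝓝 l)) :
    IntegrableOn g' (Set.Ioi 0) ∧ ∫ t in Set.Ioi (0:ℝ), g' t = l - m := by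
  set G : ℝ → ℝ := Function.update g 0 m with hG
  have hGd : ∀ t ∈ Set.Ioi (0:ℝ), HasDerivAt G (g' t) t := by
    intro t ht
    refine (hd t ht).congr_of_eventuallyEq ?_
    filter_upwards [lt_mem_nhds ht] with s hs
    simp [hG, Function.update_of_ne (ne_of_gt hs)]
  have hGc : ContinuousWithinAt G (Set.Ici 0) 0 := by
    rw [hG, continuousWithinAt_update_same]
    simpa using h0
  have hGl : Tendsto G atTop (𝓝 l) := by
    refine hl.congr' ?_
    filter_upwards [eventually_gt_atTop 0] with s hs
    simp [hG, Function.update_of_ne (ne_of_gt hs)]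
  refine ⟨integrableOn_Ioi_deriv_of_nonneg hGc hGd hpos hGl, ?_⟩
  rw [integral_Ioi_of_hasDerivAt_of_nonneg hGc hGd hpos hGl]
  simp [hG]

noncomputable def gP (z : ℝ) : ℝ := ∫ s in (0:ℝ)..z, exp (-(1/2) * s ^ 2)

lemma gP_deriv (z : ℝ) : HasDerivAt gP (exp (-(1/2) * z ^ 2)) z := by
  have hc : Continuous fun s : ℝ => exp (-(1/2) * s ^ 2) := by fun_prop
  exact intervalIntegral.integral_hasDerivAt_right (hc.intervalIntegrable _ _)
    (hc.stronglyMeasurableAtFilter _ _) hc.continuousAt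

lemma gP_top : Tendsto gP atTop (𝓝 (√(2 * π) / 2)) := by
  have h := intervalIntegral_tendsto_integral_Ioi (f := fun s : ℝ => exp (-(1/2) * s ^ 2)) (μ := volume)
    0 (integrable_exp_neg_mul_sq (by norm_num)).integrableOn tendsto_id
  rw [integral_gaussian_Ioi] at h
  have e : π / (1 / 2) = 2 * π := by ring
  rw [e] at h
  exact h

lemma gP_neg (z : ℝ) : gP (-z) = - gP z := by
  unfold gP
  have := intervalIntegral.integral_comp_neg (a := 0) (b := z) (fun s : ℝ => exp (-(1/2) * s ^ 2))
  simp only [neg_zero, even_two, Even.neg_pow] at this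
  rw [this, intervalIntegral.integral_symm]

lemma gP_bot : Tendsto gP atBot (𝓝 (-(√(2 * π) / 2))) := by
  have h := (gP_top.comp tendsto_neg_atBot_atTop).neg
  refine h.congr fun z => ?_
  simp [gP_neg]

/-- exponential weight -/
noncomputable def wE (γ u t : ℝ) : ℝ := exp (-u ^ 2 / (2 * t) - γ ^ 2 / 2 * t)

lemma arg_deriv (γ u t : ℝ) (ht : 0 < t) :
    HasDerivAt (fun t => γ * √t + u / √t) (γ / (2 * √t) - u / (2 * (t * √t))) t := by
  have hs := hasDerivAt_sqrt ht.ne'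
  have hp := sqrt_pos.2 ht
  have h := (hs.const_mul γ).add ((hasDerivAt_const t u).div hs hp.ne')
  refine h.congr_deriv ?_
  have h2 : √t ^ 2 = t := sq_sqrt ht.le
  rw [h2]
  field_simp
  ring

lemma gP_arg (γ u t : ℝ) (ht : 0 < t) :
    HasDerivAt (fun t => exp (γ * u) * gP (γ * √t + u / √t))
      (wE γ u t * (γ / (2 * √t) - u / (2 * (t * √t)))) t := by
  have h := ((gP_deriv (γ * √t + u / √t)).comp t (arg_deriv γ u t ht)).const_mul (exp (γ * u))
  refine h.congr_deriv ?_
  rw [← mul_assoc, ← exp_add, wE]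
  congr 2
  have hp := sqrt_pos.2 ht
  have h2 : √t ^ 2 = t := sq_sqrt ht.le
  have : (γ * √t + u / √t) ^ 2 = γ ^ 2 * t + 2 * γ * u + u ^ 2 / t := by
    have h3 : √t * √t = t := mul_self_sqrt ht.le
    calc _ = γ ^ 2 * √t ^ 2 + 2 * γ * u + u ^ 2 / √t ^ 2 := by field_simp; ring
      _ = _ := by rw [h2]
  rw [this]
  field_simp
  ring

lemma sqrt_inv_top : Tendsto (fun t : ℝ => 1 / √t) (𝓝[>] 0) atTop := by
  have : Tendsto (fun t : ℝ => √t) (𝓝[>] 0) (𝓝[>] 0) := by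
    refine tendsto_nhdsWithin_iff.2 ⟨?_, ?_⟩
    · have := (continuous_sqrt.tendsto 0).mono_left (nhdsWithin_le_nhds (s := Set.Ioi 0))
      simpa using this
    · filter_upwards [self_mem_nhdsWithin] with t ht using sqrt_pos.2 ht
  refine (tendsto_inv_nhdsGT_zero.comp this).congr fun t => ?_
  simp

lemma sqrt_zero : Tendsto (fun t : ℝ => √t) (𝓝[>] 0) (𝓝 0) := by
  have := (continuous_sqrt.tendsto 0).mono_left (nhdsWithin_le_nhds (s := Set.Ioi 0))
  simpa using this

lemma arg_top (γ u : ℝ) (hγ : 0 < γ) : Tendsto (fun t => γ * √t + u / √t) atTop atTop := by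
  have h1 : Tendsto (fun t => γ * √t) atTop atTop := tendsto_sqrt_atTop.const_mul_atTop hγ
  have h2 : Tendsto (fun t => u / √t) atTop (𝓝 0) := tendsto_sqrt_atTop.const_div_atTop u
  exact h1.atTop_add h2

lemma arg_zero_pos (γ u : ℝ) (hu : 0 < u) :
    Tendsto (fun t => γ * √t + u / √t) (𝓝[>] 0) atTop := by
  have h1 := sqrt_zero.const_mul γ
  have h2 := sqrt_inv_top.const_mul_atTop hu
  refine (h1.add_atTop h2).congr fun t => ?_
  ring

lemma arg_zero_neg (γ u : ℝ) (hu : 0 < u) :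
    Tendsto (fun t => γ * √t + (-u) / √t) (𝓝[>] 0) atBot := by
  have := tendsto_neg_atTop_atBot.comp (arg_zero_pos (-γ) u hu)
  refine this.congr fun t => ?_
  simp only [Function.comp]
  ring

/-- antiderivatives -/
noncomputable def FA (γ u t : ℝ) : ℝ :=
  exp (γ * (-u)) * gP (γ * √t + (-u) / √t) + exp (γ * u) * gP (γ * √t + u / √t)
noncomputable def FB (γ u t : ℝ) : ℝ :=
  exp (γ * (-u)) * gP (γ * √t + (-u) / √t) - exp (γ * u) * gP (γ * √t + u / √t)

lemma wE_neg (γ u t : ℝ) : wE γ (-u) t = wE γ u t := by simp [wE]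

lemma FA_deriv (γ u t : ℝ) (ht : 0 < t) : HasDerivAt (FA γ u) (γ * (wE γ u t / √t)) t := by
  refine ((gP_arg γ (-u) t ht).add (gP_arg γ u t ht)).congr_deriv ?_
  have hp := sqrt_pos.2 ht
  rw [wE_neg]; field_simp; ring

lemma FB_deriv (γ u t : ℝ) (ht : 0 < t) : HasDerivAt (FB γ u) (u * (wE γ u t / (t * √t))) t := by
  refine ((gP_arg γ (-u) t ht).sub (gP_arg γ u t ht)).congr_deriv ?_
  have hp := sqrt_pos.2 ht
  rw [wE_neg]; field_simp; ring

lemma FA_top (γ u : ℝ) (hγ : 0 < γ) : Tendsto (FA γ u) atTop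
    (𝓝 (exp (γ * (-u)) * (√(2 * π) / 2) + exp (γ * u) * (√(2 * π) / 2))) :=
  ((gP_top.comp (arg_top γ (-u) hγ)).const_mul _).add ((gP_top.comp (arg_top γ u hγ)).const_mul _)
lemma FB_top (γ u : ℝ) (hγ : 0 < γ) : Tendsto (FB γ u) atTop
    (𝓝 (exp (γ * (-u)) * (√(2 * π) / 2) - exp (γ * u) * (√(2 * π) / 2))) :=
  ((gP_top.comp (arg_top γ (-u) hγ)).const_mul _).sub ((gP_top.comp (arg_top γ u hγ)).const_mul _)
lemma FA_zero (γ u : ℝ) (hu : 0 < u) : Tendsto (FA γ u) (𝓝[>] 0)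
    (𝓝 (exp (γ * (-u)) * (-(√(2 * π) / 2)) + exp (γ * u) * (√(2 * π) / 2))) :=
  ((gP_bot.comp (arg_zero_neg γ u hu)).const_mul _).add ((gP_top.comp (arg_zero_pos γ u hu)).const_mul _)
lemma FB_zero (γ u : ℝ) (hu : 0 < u) : Tendsto (FB γ u) (𝓝[>] 0)
    (𝓝 (exp (γ * (-u)) * (-(√(2 * π) / 2)) - exp (γ * u) * (√(2 * π) / 2))) :=
  ((gP_bot.comp (arg_zero_neg γ u hu)).const_mul _).sub ((gP_top.comp (arg_zero_pos γ u hu)).const_mul _)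

lemma wE_pos (γ u t : ℝ) : 0 < wE γ u t := exp_pos _

lemma wE_deriv (γ u t : ℝ) (ht : 0 < t) :
    HasDerivAt (wE γ u) (wE γ u t * (u ^ 2 / (2 * t ^ 2) - γ ^ 2 / 2)) t := by
  have h1 := (hasDerivAt_const t (-u ^ 2)).div ((hasDerivAt_id t).const_mul 2) (by simp; positivity)
  have h := (h1.sub ((hasDerivAt_id t).const_mul (γ ^ 2 / 2))).exp
  refine h.congr_deriv ?_
  simp only [wE, id, Pi.div_apply, Pi.sub_apply]
  congr 1
  field_simp
  ring

lemma K_deriv (γ u t : ℝ) (ht : 0 < t) : HasDerivAt (fun t => 2 * (wE γ u t / √t))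
    (u ^ 2 * (wE γ u t / (t ^ 2 * √t)) - wE γ u t / (t * √t) - γ ^ 2 * (wE γ u t / √t)) t := by
  have hp := sqrt_pos.2 ht
  have h2 : √t ^ 2 = t := sq_sqrt ht.le
  refine (((wE_deriv γ u t ht).div (hasDerivAt_sqrt ht.ne') hp.ne').const_mul 2).congr_deriv ?_
  rw [h2]
  field_simp
  rw [h2]
  field_simp
  ring

lemma K_top (γ u : ℝ) : Tendsto (fun t => 2 * (wE γ u t / √t)) atTop (𝓝 0) := by
  have h2 : Tendsto (fun t => (2:ℝ) / √t) atTop (𝓝 0) := tendsto_sqrt_atTop.const_div_atTop 2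
  refine tendsto_of_tendsto_of_tendsto_of_le_of_le' tendsto_const_nhds h2 ?_ ?_
  · filter_upwards [eventually_gt_atTop 0] with t ht
    have := wE_pos γ u t
    positivity
  · filter_upwards [eventually_gt_atTop 0] with t ht
    have : wE γ u t ≤ 1 := by
      rw [wE, exp_le_one_iff]
      have h1 : 0 ≤ u ^ 2 / (2 * t) := by positivity
      have h2 : 0 ≤ γ ^ 2 / 2 * t := by positivity
      rw [neg_div]; linarith
    have hp := sqrt_pos.2 ht
    rw [← mul_div_assoc]
    gcongr; linarith

lemma K_zero (γ u : ℝ) (hu : 0 < u) : Tendsto (fun t => 2 * (wE γ u t / √t)) (𝓝[>] 0) (𝓝 0) := by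
  have h2 := sqrt_zero.const_mul (4 / u ^ 2)
  rw [mul_zero] at h2
  refine tendsto_of_tendsto_of_tendsto_of_le_of_le' tendsto_const_nhds h2 ?_ ?_
  · filter_upwards [self_mem_nhdsWithin] with t ht
    have := wE_pos γ u t
    positivity
  · filter_upwards [self_mem_nhdsWithin] with t ht
    have ht : 0 < t := ht
    have : wE γ u t ≤ 2 * t / u ^ 2 := by
      have h1 : wE γ u t ≤ exp (-(u ^ 2 / (2 * t))) := by
        rw [wE, exp_le_exp, neg_div]
        have h2 : 0 ≤ γ ^ 2 / 2 * t := by positivity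
        linarith
      refine h1.trans ?_
      have h3 := add_one_le_exp (u ^ 2 / (2 * t))
      have h4 : 0 < u ^ 2 / (2 * t) := by positivity
      rw [exp_neg, inv_le_comm₀ (exp_pos _) (by positivity), inv_div]
      linarith
    have hp := sqrt_pos.2 ht
    calc 2 * (wE γ u t / √t) ≤ 2 * ((2 * t / u ^ 2) / √t) := by gcongr
      _ = 4 / u ^ 2 * √t := by
        have h2 : √t ^ 2 = t := sq_sqrt ht.le
        field_simp; rw [h2]; ring

lemma int_A (γ u : ℝ) (hγ : 0 < γ) (hu : 0 < u) :
    IntegrableOn (fun t => γ * (wE γ u t / √t)) (Set.Ioi 0) ∧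
    ∫ t in Set.Ioi (0:ℝ), γ * (wE γ u t / √t) = √(2 * π) * exp (-(γ * u)) := by
  have := aux_ftc (FA_deriv γ u) (fun t ht => by have := wE_pos γ u t; positivity)
    (FA_zero γ u hu) (FA_top γ u hγ)
  refine ⟨this.1, this.2.trans ?_⟩
  rw [mul_neg γ u]; ring

lemma int_B (γ u : ℝ) (hγ : 0 < γ) (hu : 0 < u) :
    IntegrableOn (fun t => u * (wE γ u t / (t * √t))) (Set.Ioi 0) ∧
    ∫ t in Set.Ioi (0:ℝ), u * (wE γ u t / (t * √t)) = √(2 * π) * exp (-(γ * u)) := by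
  have := aux_ftc (FB_deriv γ u) (fun t ht => by have := wE_pos γ u t; positivity)
    (FB_zero γ u hu) (FB_top γ u hγ)
  refine ⟨this.1, this.2.trans ?_⟩
  rw [mul_neg γ u]; ring

lemma int_B' (γ u : ℝ) (hγ : 0 < γ) (hu : 0 < u) :
    IntegrableOn (fun t => wE γ u t / (t * √t)) (Set.Ioi 0) ∧
    ∫ t in Set.Ioi (0:ℝ), wE γ u t / (t * √t) = √(2 * π) * exp (-(γ * u)) / u := by
  obtain ⟨h1, h2⟩ := int_B γ u hγ hu
  constructor
  · have := h1.const_mul u⁻¹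
    refine this.congr (ae_of_all _ fun t => ?_)
    simp only; field_simp
  · rw [integral_const_mul] at h2
    rw [← h2]; field_simp

lemma int_C (γ u : ℝ) (hγ : 0 < γ) (hu : 0 < u) :
    IntegrableOn (fun t => u ^ 2 * (wE γ u t / (t ^ 2 * √t))) (Set.Ioi 0) ∧
    ∫ t in Set.Ioi (0:ℝ), u ^ 2 * (wE γ u t / (t ^ 2 * √t)) =
      √(2 * π) * exp (-(γ * u)) / u + γ * (√(2 * π) * exp (-(γ * u))) := by
  have := aux_ftc (g := fun t => 2 * (wE γ u t / √t) + u⁻¹ * FB γ u t + γ * FA γ u t)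
    (g' := fun t => u ^ 2 * (wE γ u t / (t ^ 2 * √t)))
    (fun t ht => by
      refine (((K_deriv γ u t ht).add ((FB_deriv γ u t ht).const_mul u⁻¹)).add
        ((FA_deriv γ u t ht).const_mul γ)).congr_deriv ?_
      field_simp
      ring)
    (fun t ht => by have := wE_pos γ u t; positivity)
    (((K_zero γ u hu).add ((FB_zero γ u hu).const_mul u⁻¹)).add ((FA_zero γ u hu).const_mul γ))
    (((K_top γ u).add ((FB_top γ u hγ).const_mul u⁻¹)).add ((FA_top γ u hγ).const_mul γ))
  refine ⟨this.1, this.2.trans ?_⟩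
  rw [mul_neg γ u]; ring

lemma int_E1 (γ c d : ℝ) (hγ : 0 < γ) :
    ∫ u in Set.Ioi c, exp (-(γ * u)) / (u + d) = exp (γ * d) * E1 (γ * (c + d)) := by
  have him : (fun u => γ * (u + d)) '' Set.Ioi c = Set.Ioi (γ * (c + d)) := by
    ext z
    simp only [Set.mem_image, Set.mem_Ioi]
    constructor
    · rintro ⟨u, hu, rfl⟩
      gcongr
    · intro hz
      refine ⟨z / γ - d, ?_, by field_simp; ring⟩
      rw [lt_sub_iff_add_lt, lt_div_iff₀ hγ]; linarith
  have h := integral_image_eq_integral_abs_deriv_smul (s := Set.Ioi c)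
    (f := fun u => γ * (u + d)) (f' := fun _ => γ) measurableSet_Ioi
    (fun u _ => by simpa using (((hasDerivAt_id u).add_const d).const_mul γ).hasDerivWithinAt)
    (fun u _ v _ h => by simpa [hγ.ne'] using h) (fun u => exp (-u) / u)
  rw [him] at h
  rw [E1, h, ← integral_const_mul]
  refine setIntegral_congr_fun measurableSet_Ioi fun u _ => ?_
  simp only [smul_eq_mul, abs_of_pos hγ]
  rw [show -(γ * u) = γ * d + -(γ * (u + d)) by ring, exp_add]
  field_simp

lemma int_sq (c : ℝ) (hc : 0 < c) (g : ℝ → ℝ) :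
    ∫ y in Set.Ioi (c ^ 2), g y = ∫ u in Set.Ioi c, 2 * u * g (u ^ 2) := by
  have him : (fun u => u ^ 2) '' Set.Ioi c = Set.Ioi (c ^ 2) := by
    ext z
    simp only [Set.mem_image, Set.mem_Ioi]
    constructor
    · rintro ⟨u, hu, rfl⟩
      gcongr
    · intro hz
      exact ⟨√z, lt_sqrt_of_sq_lt hz, sq_sqrt ((sq_nonneg c).trans hz.le)⟩
  have h := integral_image_eq_integral_abs_deriv_smul (s := Set.Ioi c)
    (f := fun u => u ^ 2) (f' := fun u => 2 * u) measurableSet_Ioi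
    (fun u _ => by simpa using (hasDerivAt_pow 2 u).hasDerivWithinAt)
    (fun u hu v hv h => by
      have hu : c < u := hu
      have hv : c < v := hv
      exact (pow_left_inj₀ (hc.trans hu).le (hc.trans hv).le two_ne_zero).1 h) g
  rw [him] at h
  rw [h]
  refine setIntegral_congr_fun measurableSet_Ioi fun u hu => ?_
  have hu : c < u := hu
  have : 0 < 2 * u := by linarith
  simp only [smul_eq_mul, abs_of_pos this]

lemma int_R (γ u : ℝ) (hγ : 0 < γ) (hu : 0 < u) :
    ∫ t in Set.Ioi (0:ℝ), (u ^ 2 * (wE γ u t / (t ^ 2 * √t)) - wE γ u t / (t * √t)) =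
      √(2 * π) * (γ * exp (-(γ * u))) := by
  rw [integral_sub (int_C γ u hγ hu).1 (int_B' γ u hγ hu).1, (int_C γ u hγ hu).2,
    (int_B' γ u hγ hu).2]
  ring

lemma exp_intOn (γ c : ℝ) (hγ : 0 < γ) : IntegrableOn (fun u => exp (-(γ * u))) (Set.Ioi c) := by
  simpa using exp_neg_integrableOn_Ioi c hγ

lemma dom_int (γ c M : ℝ) (hγ : 0 < γ) (hc : 0 < c) :
    Integrable (fun p : ℝ × ℝ => (p.2 ^ 2 * (wE γ p.2 p.1 / (p.1 ^ 2 * √p.1)) +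
      wE γ p.2 p.1 / (p.1 * √p.1)) * M)
      ((volume.restrict (Set.Ioi 0)).prod (volume.restrict (Set.Ioi c))) := by
  refine Integrable.mul_const ?_ M
  have hm : Measurable (fun p : ℝ × ℝ => (p.2 ^ 2 * (wE γ p.2 p.1 / (p.1 ^ 2 * √p.1)) +
      wE γ p.2 p.1 / (p.1 * √p.1))) := by
    unfold wE
    fun_prop
  rw [integrable_prod_iff' hm.aestronglyMeasurable]
  constructor
  · filter_upwards [ae_restrict_mem measurableSet_Ioi] with u hu
    have hu0 : 0 < u := hc.trans hu
    exact (int_C γ u hγ hu0).1.add (int_B' γ u hγ hu0).1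
  · have h1 : Integrable (fun u => √(2 * π) * (γ + 2 / u) * exp (-(γ * u)))
        (volume.restrict (Set.Ioi c)) := by
      refine Integrable.mono' ((exp_intOn γ c hγ).const_mul (√(2 * π) * (γ + 2 / c)))
        (Measurable.aestronglyMeasurable (by fun_prop)) ?_
      filter_upwards [ae_restrict_mem measurableSet_Ioi] with u hu
      have hu1 : c < u := hu
      have hu0 : 0 < u := hc.trans hu
      rw [norm_of_nonneg (by positivity)]
      gcongr
    refine h1.congr ?_
    filter_upwards [ae_restrict_mem measurableSet_Ioi] with u hu
    have hu0 : 0 < u := hc.trans hu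
    have h2 : ∫ t in Set.Ioi (0:ℝ), ‖u ^ 2 * (wE γ u t / (t ^ 2 * √t)) + wE γ u t / (t * √t)‖ =
        ∫ t in Set.Ioi (0:ℝ), (u ^ 2 * (wE γ u t / (t ^ 2 * √t)) + wE γ u t / (t * √t)) := by
      refine setIntegral_congr_fun measurableSet_Ioi fun t ht => ?_
      have ht : 0 < t := ht
      have := wE_pos γ u t
      exact norm_of_nonneg (by positivity)
    rw [h2, integral_add (int_C γ u hγ hu0).1 (int_B' γ u hγ hu0).1, (int_C γ u hγ hu0).2,
      (int_B' γ u hγ hu0).2]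
    ring

lemma swap (γ c M : ℝ) (hγ : 0 < γ) (hc : 0 < c) (k : ℝ → ℝ) (hk : Measurable k)
    (hM : ∀ u, c < u → |k u| ≤ M) :
    Integrable (fun t => ∫ u in Set.Ioi c,
      (u ^ 2 * (wE γ u t / (t ^ 2 * √t)) - wE γ u t / (t * √t)) * k u)
      (volume.restrict (Set.Ioi 0)) ∧
    ∫ t in Set.Ioi (0:ℝ), ∫ u in Set.Ioi c,
      (u ^ 2 * (wE γ u t / (t ^ 2 * √t)) - wE γ u t / (t * √t)) * k u =
    √(2 * π) * γ * ∫ u in Set.Ioi c, exp (-(γ * u)) * k u := by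
  have hi : Integrable (Function.uncurry fun t u =>
      (u ^ 2 * (wE γ u t / (t ^ 2 * √t)) - wE γ u t / (t * √t)) * k u)
      ((volume.restrict (Set.Ioi 0)).prod (volume.restrict (Set.Ioi c))) := by
    refine Integrable.mono' (dom_int γ c M hγ hc) (Measurable.aestronglyMeasurable ?_) ?_
    · unfold wE Function.uncurry
      fun_prop
    · rw [Measure.prod_restrict]
      filter_upwards [ae_restrict_mem (measurableSet_Ioi.prod measurableSet_Ioi)] with p hp
      obtain ⟨t, u⟩ := p
      have ht : 0 < t := hp.1
      have hu : c < u := hp.2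
      have hw := wE_pos γ u t
      simp only [Function.uncurry]
      rw [norm_mul]
      refine mul_le_mul ?_ (hM u hu) (norm_nonneg _) (by positivity)
      refine (norm_sub_le _ _).trans ?_
      rw [norm_of_nonneg (by positivity), norm_of_nonneg (by positivity)]
  refine ⟨hi.integral_prod_left, ?_⟩
  rw [integral_integral_swap hi, ← integral_const_mul]
  refine setIntegral_congr_fun measurableSet_Ioi fun u hu => ?_
  rw [integral_mul_const, int_R γ u hγ (hc.trans hu)]
  ring

lemma rpow52 (t : ℝ) (ht : 0 < t) : t ^ (-(5 / 2 : ℝ)) = 1 / (t ^ 2 * √t) := by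
  rw [rpow_neg ht.le, show (5 / 2 : ℝ) = (2:ℕ) + 1 / 2 by norm_num, rpow_add ht, rpow_natCast,
    ← sqrt_eq_rpow, one_div]

lemma pG (u t : ℝ) (hu : 0 < u) (ht : 0 < t) :
    2 * u * (pGamma (u ^ 2) (3 / 2) (1 / (2 * t)) - pGamma (u ^ 2) (1 / 2) (1 / (2 * t))) =
    2 * t * ((u ^ 2 - t) / (t ^ 2 * √t) * exp (-u ^ 2 / (2 * t))) / √(2 * π) := by
  have hG : Real.Gamma (3 / 2) = √π / 2 := by
    rw [show (3 / 2 : ℝ) = 1 / 2 + 1 by norm_num, Real.Gamma_add_one (by norm_num),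
      Real.Gamma_one_half_eq]
    ring
  have hs : (0:ℝ) < 1 / (2 * t) := by positivity
  have h1 : (1 / (2 * t)) ^ (3 / 2 : ℝ) = 1 / (2 * t) * (1 / (√2 * √t)) := by
    rw [show (3 / 2 : ℝ) = 1 + 1 / 2 by norm_num, rpow_add hs, rpow_one, ← sqrt_eq_rpow,
      sqrt_div zero_le_one, sqrt_one, sqrt_mul zero_le_two]
  have h2 : (1 / (2 * t)) ^ (1 / 2 : ℝ) = (1 / (√2 * √t)) := by
    rw [← sqrt_eq_rpow, sqrt_div zero_le_one, sqrt_one, sqrt_mul zero_le_two]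
  have h3 : (u ^ 2) ^ ((3 / 2 : ℝ) - 1) = u := by
    rw [show (3 / 2 : ℝ) - 1 = 1 / 2 by norm_num, ← sqrt_eq_rpow, sqrt_sq hu.le]
  have h4 : (u ^ 2) ^ ((1 / 2 : ℝ) - 1) = u⁻¹ := by
    rw [show (1 / 2 : ℝ) - 1 = -(1 / 2) by norm_num, rpow_neg (by positivity), ← sqrt_eq_rpow,
      sqrt_sq hu.le]
  have h5 : -(1 / (2 * t)) * u ^ 2 = -u ^ 2 / (2 * t) := by ring
  rw [pGamma, pGamma, hG, Real.Gamma_one_half_eq, h1, h2, h3, h4, h5, sqrt_mul zero_le_two]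
  have := sqrt_pos.2 ht
  have := sqrt_pos.2 pi_pos
  field_simp

/-- Laplace transform of the η-function for the first-order Bessel perturbation:
∫₀^∞ e^{−βt} η(x,t) dt = −γ e^{−γ(x−a)} (ln(a/x) + e^{2γa}E₁(2γa) + e^{2γx}E₁(2γx))/2. -/
theorem stmt_18 (a x β : ℝ) (ha : 0 < a) (hax : a < x) (hβ : 0 < β)
    (γ : ℝ) (hγ : γ = Real.sqrt (2 * β))
    (ρ : ℝ → ℝ)
    (hρ : ∀ t : ℝ, 0 < t → ρ t =
      (2 * Real.pi) ^ (-(1 / 2 : ℝ)) * t ^ (-(5 / 2 : ℝ)) * ((x - a) ^ 2 - t) *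
        Real.exp (-(x - a) ^ 2 / (2 * t)))
    (η : ℝ → ℝ → ℝ)
    (hη : ∀ t : ℝ, 0 < t → η x t =
      (1 / 2) * Real.log (x / a) * ρ t -
        (1 / (4 * t)) *
          ∫ y in Set.Ioi ((x - a) ^ 2),
            (pGamma y (3 / 2) (1 / (2 * t)) - pGamma y (1 / 2) (1 / (2 * t))) *
              (1 / (Real.sqrt y - x + 3 * a) + 1 / (Real.sqrt y + x + a))) :
    ∫ t in Set.Ioi (0 : ℝ), Real.exp (-β * t) * η x t =
      -γ * Real.exp (-(γ * (x - a))) *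
        (Real.log (a / x) + Real.exp (2 * γ * a) * E1 (2 * γ * a) +
          Real.exp (2 * γ * x) * E1 (2 * γ * x)) / 2 := by
  
  have hγ0 : 0 < γ := by rw [hγ]; positivity
  have hβγ : β = γ ^ 2 / 2 := by rw [hγ, sq_sqrt (by positivity)]; ring
  obtain ⟨c, hc⟩ : ∃ c, c = x - a := ⟨_, rfl⟩
  have hc0 : 0 < c := by rw [hc]; linarith
  have hx0 : 0 < x := ha.trans hax
  set k : ℝ → ℝ := fun u => 1 / (u - x + 3 * a) + 1 / (u + x + a) with hk
  have hkm : Measurable k := by fun_prop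
  have hM : ∀ u, c < u → |k u| ≤ 1 / (2 * a) + 1 / (2 * x) := by
    intro u hu
    have h1 : 2 * a ≤ u - x + 3 * a := by linarith
    have h2 : 2 * x ≤ u + x + a := by linarith
    have h3 : 0 < u - x + 3 * a := by linarith
    have h4 : 0 < u + x + a := by linarith
    have h5 : k u = 1 / (u - x + 3 * a) + 1 / (u + x + a) := rfl
    rw [h5, abs_of_nonneg (by positivity)]
    gcongr
  obtain ⟨hsi, hs⟩ := swap γ c _ hγ0 hc0 k hkm hM
  have hpt : ∀ t ∈ Set.Ioi (0:ℝ), exp (-β * t) * η x t =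
      (1 / 2 * log (x / a) / √(2 * π)) *
        (c ^ 2 * (wE γ c t / (t ^ 2 * √t)) - wE γ c t / (t * √t)) -
      (1 / 2 / √(2 * π)) * ∫ u in Set.Ioi c,
        (u ^ 2 * (wE γ u t / (t ^ 2 * √t)) - wE γ u t / (t * √t)) * k u := by
    intro t ht
    have ht : 0 < t := ht
    have hst := sqrt_pos.2 ht
    have hw : ∀ u, wE γ u t = exp (-β * t) * exp (-u ^ 2 / (2 * t)) := by
      intro u
      rw [wE, ← exp_add, hβγ]; congr 1; ring
    rw [hη t ht, hρ t ht, ← hc, int_sq c hc0, mul_sub]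
    congr 1
    · rw [rpow52 t ht, rpow_neg (by positivity), ← sqrt_eq_rpow, hw]
      field_simp
    · rw [← mul_assoc, ← integral_const_mul, ← integral_const_mul]
      refine setIntegral_congr_fun measurableSet_Ioi fun u hu => ?_
      have hu0 : 0 < u := hc0.trans hu
      simp only [sqrt_sq hu0.le]
      rw [← mul_assoc (2 * u), pG u t hu0 ht, hw]
      change _ * (_ * k u) = _
      field_simp
      ring
  have hci : Integrable (fun t => c ^ 2 * (wE γ c t / (t ^ 2 * √t)) - wE γ c t / (t * √t))
      (volume.restrict (Set.Ioi 0)) := (int_C γ c hγ0 hc0).1.sub (int_B' γ c hγ0 hc0).1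
  rw [setIntegral_congr_fun measurableSet_Ioi hpt, integral_sub (hci.const_mul _) (hsi.const_mul _),
    integral_const_mul, integral_const_mul, int_R γ c hγ0 hc0, hs]
  have hb : ∀ d, 0 < c + d → IntegrableOn (fun u => exp (-(γ * u)) / (u + d)) (Set.Ioi c) := by
    intro d hd
    refine Integrable.mono' ((exp_intOn γ c hγ0).div_const (c + d))
      (Measurable.aestronglyMeasurable (by fun_prop)) ?_
    filter_upwards [ae_restrict_mem measurableSet_Ioi] with u hu
    have hu1 : c < u := hu
    have : 0 < u + d := by linarith
    rw [norm_of_nonneg (by positivity)]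
    gcongr
  have hI : ∫ u in Set.Ioi c, exp (-(γ * u)) * k u =
      exp (-(γ * c)) * (exp (2 * γ * a) * E1 (2 * γ * a) + exp (2 * γ * x) * E1 (2 * γ * x)) := by
    have h1 : ∀ u ∈ Set.Ioi c, exp (-(γ * u)) * k u =
        exp (-(γ * u)) / (u + (3 * a - x)) + exp (-(γ * u)) / (u + (x + a)) := by
      intro u _
      rw [hk]
      simp only
      rw [show u - x + 3 * a = u + (3 * a - x) by ring, show u + x + a = u + (x + a) by ring]
      ring
    rw [setIntegral_congr_fun measurableSet_Ioi h1,
      integral_add (hb _ (by linarith)) (hb _ (by linarith)), int_E1 _ _ _ hγ0, int_E1 _ _ _ hγ0,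
      show γ * (c + (3 * a - x)) = 2 * γ * a by rw [hc]; ring,
      show γ * (c + (x + a)) = 2 * γ * x by rw [hc]; ring,
      show γ * (3 * a - x) = -(γ * c) + 2 * γ * a by rw [hc]; ring,
      show γ * (x + a) = -(γ * c) + 2 * γ * x by rw [hc]; ring, exp_add, exp_add]
    ring
  rw [hI, ← hc, log_div hx0.ne' ha.ne', log_div ha.ne' hx0.ne']
  have : 0 < √(2 * π) := by positivity
  field_simp
  ring
end
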